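/- arXiv:2507.19181 — 2 statements merged into one kernel-verified Lean document; each statement's English description precedes it below -/
import Mathlib

section
/- Let τ be a nonempty finite set (a cluster of graph vertices), φ : τ → ℝ^q a coordinate map, v₀ ∈ τ a distinguished vertex, d : τ → [0,∞) a function (the graph distance to v₀), γ ≥ 0 and C > 0. Let f : τ → ℝ and suppose there exists a multivariate polynomial P in q real variables with total degree at most ⌊γ⌋ such that |f(v) − P(φ(v) − φ(v₀))| ≤ C · d(v)^γ for every v ∈ τ. Let ω : τ → ℝ satisfy Σ_{v∈τ} ω(v)² = 1 and the vanishing-moments property: Σ_{v∈τ} ω(v) · Q(φ(v)) = 0 for every multivariate polynomial Q in q real variables of total degree at most ⌊γ⌋. Then |Σ_{v∈τ} ω(v) · f(v)| ≤ C · (max_{v∈τ} d(v)^γ) · √(|τ|). -/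
theorem samplet_shift_totalDegree {q : ℕ} (P : MvPolynomial (Fin q) ℝ) (a : Fin q → ℝ) :
    (MvPolynomial.bind₁ (fun j => MvPolynomial.X j - MvPolynomial.C (a j)) P).totalDegree
      ≤ P.totalDegree := by
  conv_lhs => rw [P.as_sum, map_sum]
  apply MvPolynomial.totalDegree_finsetSum_le
  intro m hm
  rw [MvPolynomial.bind₁_monomial]
  refine (MvPolynomial.totalDegree_mul _ _).trans ?_
  rw [MvPolynomial.totalDegree_C, zero_add]
  refine (MvPolynomial.totalDegree_finsetProd _ _).trans ?_
  refine le_trans ?_ (MvPolynomial.le_totalDegree hm)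
  rw [Finsupp.sum]
  apply Finset.sum_le_sum
  intro i _
  refine (MvPolynomial.totalDegree_pow _ _).trans ?_
  have h : (MvPolynomial.X i - MvPolynomial.C (a i) : MvPolynomial (Fin q) ℝ).totalDegree ≤ 1 := by
    refine (MvPolynomial.totalDegree_sub_C_le _ _).trans ?_
    rw [MvPolynomial.totalDegree_X]
  nlinarith

/-- Proposition 4.1: decay estimate for samplet coefficients of a signal in the
microlocal class `C^γ_G(C, v₀)` on a cluster `τ` with coordinate map `φ`. -/
theorem samplet_coefficient_decay
    {τ : Type*} [Fintype τ] [Nonempty τ] {q : ℕ}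
    (φ : τ → EuclideanSpace ℝ (Fin q)) (v₀ : τ)
    (d : τ → ℝ) (hd : ∀ v, 0 ≤ d v)
    (γ : ℝ) (hγ : 0 ≤ γ) (C : ℝ) (hC : 0 < C)
    (f : τ → ℝ)
    (P : MvPolynomial (Fin q) ℝ) (hPdeg : P.totalDegree ≤ ⌊γ⌋₊)
    (hP : ∀ v : τ,
      |f v - MvPolynomial.eval (fun j => φ v j - φ v₀ j) P| ≤ C * d v ^ γ)
    (ω : τ → ℝ) (hω : ∑ v : τ, ω v ^ 2 = 1)
    (hvm : ∀ Q : MvPolynomial (Fin q) ℝ, Q.totalDegree ≤ ⌊γ⌋₊ →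
      ∑ v : τ, ω v * MvPolynomial.eval (fun j => φ v j) Q = 0) :
    |∑ v : τ, ω v * f v| ≤
      C * (Finset.univ.sup' Finset.univ_nonempty fun v : τ => d v ^ γ) *
        Real.sqrt (Fintype.card τ) := by
  have h0 := hvm _ ((samplet_shift_totalDegree P (fun j => φ v₀ j)).trans hPdeg)
  have he : ∀ v : τ, MvPolynomial.eval (fun j => φ v j)
      (MvPolynomial.bind₁ (fun j => MvPolynomial.X j - MvPolynomial.C (φ v₀ j)) P)
      = MvPolynomial.eval (fun j => φ v j - φ v₀ j) P := by
    intro v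
    rw [MvPolynomial.eval, MvPolynomial.eval₂Hom_bind₁]
    simp only [MvPolynomial.coe_eval₂Hom, map_sub, MvPolynomial.eval₂_X, MvPolynomial.eval₂_C, RingHom.id_apply]
    rfl
  simp only [he] at h0
  set M := Finset.univ.sup' Finset.univ_nonempty fun v : τ => d v ^ γ with hM
  have hle : ∀ v, d v ^ γ ≤ M := fun v =>
    Finset.le_sup' (fun v : τ => d v ^ γ) (Finset.mem_univ v)
  have hM0 : 0 ≤ M := (Real.rpow_nonneg (hd v₀) γ).trans (hle v₀)
  have h1 : ∑ v : τ, ω v * f v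
      = ∑ v : τ, ω v * (f v - MvPolynomial.eval (fun j => φ v j - φ v₀ j) P) := by
    simp only [mul_sub, Finset.sum_sub_distrib, h0, sub_zero]
  rw [h1]
  refine abs_le_of_sq_le_sq ?_ (by positivity)
  refine (Finset.sum_mul_sq_le_sq_mul_sq _ _ _).trans ?_
  rw [hω, one_mul, mul_pow, Real.sq_sqrt (Nat.cast_nonneg _)]
  have h2 : ∀ v ∈ (Finset.univ : Finset τ),
      (f v - MvPolynomial.eval (fun j => φ v j - φ v₀ j) P) ^ 2 ≤ (C * M) ^ 2 := by
    intro v _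
    apply sq_le_sq'
    · have := abs_le.mp ((hP v).trans (mul_le_mul_of_nonneg_left (hle v) hC.le))
      exact this.1
    · have := abs_le.mp ((hP v).trans (mul_le_mul_of_nonneg_left (hle v) hC.le))
      exact this.2
  refine (Finset.sum_le_sum h2).trans ?_
  simp [mul_comm]
end

section
/- Let M be a real m×n matrix (the moment matrix), Q a real n×n orthogonal matrix, and R a real n×m matrix that is upper triangular in the sense that R_{k,i} = 0 whenever k > i (indices viewed as natural numbers). If Mᵀ = Q·R, then for every column index k ≥ m (as a natural number) the k-th column q_k of Q satisfies M·q_k = 0, i.e., all distributions generated past the first m columns annihilate every row of the moment matrix. -/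
open Matrix

/-- Vanishing moments of samplets: if `Mᵀ = Q·R` with `Q` orthogonal and `R`
upper triangular, then every column `q_k` of `Q` with `k ≥ m` satisfies
`M·q_k = 0`, i.e., the corresponding distribution annihilates every row of
the moment matrix. -/
theorem samplet_vanishing_moments_of_qr
    {m n : ℕ} (M : Matrix (Fin m) (Fin n) ℝ)
    (Q : Matrix (Fin n) (Fin n) ℝ) (hQ : Qᵀ * Q = 1)
    (R : Matrix (Fin n) (Fin m) ℝ)
    (hR : ∀ (k : Fin n) (i : Fin m), (i : ℕ) < (k : ℕ) → R k i = 0)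
    (hQR : Mᵀ = Q * R) :
    ∀ k : Fin n, m ≤ (k : ℕ) → M.mulVec (fun j => Q j k) = 0 := by
  intro k hk
  have h1 : M * Q = Rᵀ := by
    have h2 : M = Rᵀ * Qᵀ := by
      rw [← Matrix.transpose_mul, ← hQR, Matrix.transpose_transpose]
    rw [h2, Matrix.mul_assoc, hQ, Matrix.mul_one]
  funext i
  have h3 : (M * Q) i k = 0 := by
    rw [h1, Matrix.transpose_apply]
    exact hR k i (lt_of_lt_of_le i.isLt hk)
  exact h3
end
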